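/- arXiv:1506.03872 — 2 statements merged into one kernel-verified Lean document; each statement's English description precedes it below -/
import Mathlib

section
/- Assume all entries of A and B are nonnegative. Then for every pair (i,j) ∈ [m]×[n], the probability under the wedge-sampling distribution that the sampled wedge has endpoints (i,j) (i.e., the probability of the set of triples (i,k,j) over all k ∈ [d]) equals c_{ij} / ‖w‖₁, where c_{ij} = ∑_{k=1}^d a_{ki}·b_{kj}. In particular, this probability is proportional to the dot product of the i-th column of A with the j-th column of B. -/
open Finset

theorem sum_abs_ne_zero {ι : Type*} [Fintype ι] {f : ι → ℝ} (h : ∃ i, f i ≠ 0) :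
    ∑ i, |f i| ≠ 0 := by
  obtain ⟨i, hi⟩ := h
  exact (sum_pos' (fun _ _ => abs_nonneg _) ⟨i, mem_univ i, abs_pos.mpr hi⟩).ne'

/-- For nonnegative matrices, the wedge-sampling probability that the sampled
wedge has endpoints `(i, j)` equals `c_{ij} / ‖w‖₁`. -/
theorem wedge_sampling_endpoint_prob
    (d m n : ℕ) (hd : 0 < d) (hm : 0 < m) (hn : 0 < n)
    (A : Matrix (Fin d) (Fin m) ℝ) (B : Matrix (Fin d) (Fin n) ℝ)
    (hA0 : ∀ k i, 0 ≤ A k i) (hB0 : ∀ k j, 0 ≤ B k j)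
    (w1 : ℝ)
    (hw1 : w1 = ∑ k : Fin d, (∑ i : Fin m, |A k i|) * (∑ j : Fin n, |B k j|))
    (hw1pos : 0 < w1)
    (hArow : ∀ k : Fin d, ∃ i : Fin m, A k i ≠ 0)
    (hBrow : ∀ k : Fin d, ∃ j : Fin n, B k j ≠ 0)
    (p : Fin m × Fin d × Fin n → ℝ)
    (hp : ∀ (i0 : Fin m) (l : Fin d) (j0 : Fin n),
        p (i0, l, j0)
          = (((∑ i' : Fin m, |A l i'|) * (∑ j' : Fin n, |B l j'|)) / w1)
            * (|A l i0| / (∑ i' : Fin m, |A l i'|))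
            * (|B l j0| / (∑ j' : Fin n, |B l j'|)))
    (i : Fin m) (j : Fin n) :
    ∑ k : Fin d, p (i, k, j) = (∑ k : Fin d, A k i * B k j) / w1 := by
  rw [sum_div]
  refine sum_congr rfl fun k _ => ?_
  have hA := sum_abs_ne_zero (hArow k)
  have hB := sum_abs_ne_zero (hBrow k)
  rw [hp, abs_of_nonneg (hA0 k i), abs_of_nonneg (hB0 k j)]
  field_simp
end

section
/- Suppose B = A (so C = AᵀA). Then the matrix of single-sample expectations is symmetric: for all i, j ∈ [m], the expectation under the diamond-sampling distribution of Z_{ij} equals the expectation of Z_{ji}, where Z_{ij}(k',i₀,k,j₀) = sgn(a_{ki}·a_{kj}·a_{k'i})·a_{k'j} if (i₀,j₀) = (i,j) and 0 otherwise; both expectations equal c_{ij}²/‖W‖₁ with c_{ij} = ∑_k a_{ki}·a_{kj} = c_{ji}. -/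
open Finset

/-- `sgn x = 1` if `x ≥ 0` and `-1` otherwise. -/
noncomputable def sgn (x : ℝ) : ℝ := if 0 ≤ x then 1 else -1

/-- Multiplying by the modulus recovers a real number from its sign. -/
lemma abs_mul_sgn (x : ℝ) : |x| * sgn x = x := by
  unfold sgn
  split_ifs with h
  · rw [abs_of_nonneg h, mul_one]
  · rw [abs_of_neg (not_le.mp h)]
    ring

/-- The single-sample expectation of the `(i, j)` estimator is `c_{ij}² / ‖W‖₁`. -/
lemma gram_diamond_expectation {κ ι : Type*} [Fintype κ] [Fintype ι] [DecidableEq ι]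
    (A : Matrix κ ι ℝ) (W1 : ℝ)
    (hAcol : ∀ i, ∃ k, A k i ≠ 0) (hArow : ∀ k, ∃ j, A k j ≠ 0)
    (p : κ × ι × κ × ι → ℝ)
    (hp : ∀ l' i0 l j0, p (l', i0, l, j0)
      = ((|A l i0| * (∑ k'', |A k'' i0|) * (∑ j', |A l j'|)) / W1)
        * (|A l j0| / (∑ j', |A l j'|)) * (|A l' i0| / (∑ k'', |A k'' i0|)))
    (i j : ι) (Z : κ × ι × κ × ι → ℝ)
    (hZ : ∀ l' i0 l j0, Z (l', i0, l, j0)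
      = if i0 = i ∧ j0 = j then sgn (A l i * A l j * A l' i) * A l' j else 0) :
    ∑ q, p q * Z q = (∑ k, A k i * A k j) ^ 2 / W1 := by
  have hcol : ∑ k, |A k i| ≠ 0 := by
    obtain ⟨k, hk⟩ := hAcol i
    exact (sum_pos' (fun _ _ => abs_nonneg _) ⟨k, mem_univ _, abs_pos.mpr hk⟩).ne'
  have hrow (l : κ) : ∑ j', |A l j'| ≠ 0 := by
    obtain ⟨j', hj'⟩ := hArow l
    exact (sum_pos' (fun _ _ => abs_nonneg _) ⟨j', mem_univ _, abs_pos.mpr hj'⟩).ne'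
  have hterm (l' l : κ) : p (l', i, l, j) * (sgn (A l i * A l j * A l' i) * A l' j)
      = (A l' i * A l' j) * (A l i * A l j) / W1 := by
    have hs := abs_mul_sgn (A l i * A l j * A l' i)
    rw [abs_mul, abs_mul] at hs
    have hw : p (l', i, l, j) = |A l i| * |A l j| * |A l' i| / W1 := by
      rw [hp]
      have := hrow l
      field_simp
    rw [hw]
    linear_combination (A l' j / W1) * hs
  simp only [Fintype.sum_prod_type, hZ, ite_and, mul_ite, mul_zero]
  rw [sq, sum_mul_sum, sum_div]
  refine sum_congr rfl fun l' _ => ?_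
  rw [sum_div, sum_eq_single i (fun b _ hb => by simp [hb]) (by simp)]
  refine sum_congr rfl fun l _ => ?_
  simpa using hterm l' l

/-- When `B = A` (Gram matrix case), the matrix of single-sample expectations is
symmetric: the expectations of `Z_{ij}` and `Z_{ji}` under the diamond-sampling
distribution both equal `c_{ij}² / ‖W‖₁` with `c_{ij} = ∑_k a_{ki} a_{kj} = c_{ji}`. -/
theorem gram_diamond_expectation_symmetric
    (d m : ℕ) (hd : 0 < d) (hm : 0 < m)
    (A : Matrix (Fin d) (Fin m) ℝ)
    (W1 : ℝ)
    (hW1 : W1 = ∑ k : Fin d, ∑ i : Fin m,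
        |A k i| * (∑ k' : Fin d, |A k' i|) * (∑ j : Fin m, |A k j|))
    (hW1pos : 0 < W1)
    (hAcol : ∀ i : Fin m, ∃ k : Fin d, A k i ≠ 0)
    (hArow : ∀ k : Fin d, ∃ j : Fin m, A k j ≠ 0)
    (p : Fin d × Fin m × Fin d × Fin m → ℝ)
    (hp : ∀ (l' : Fin d) (i0 : Fin m) (l : Fin d) (j0 : Fin m),
        p (l', i0, l, j0)
          = ((|A l i0| * (∑ k'' : Fin d, |A k'' i0|) * (∑ j' : Fin m, |A l j'|)) / W1)
            * (|A l j0| / (∑ j' : Fin m, |A l j'|))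
            * (|A l' i0| / (∑ k'' : Fin d, |A k'' i0|)))
    (i j : Fin m)
    (Zij Zji : Fin d × Fin m × Fin d × Fin m → ℝ)
    (hZij : ∀ (l' : Fin d) (i0 : Fin m) (l : Fin d) (j0 : Fin m),
        Zij (l', i0, l, j0)
          = if i0 = i ∧ j0 = j then sgn (A l i * A l j * A l' i) * A l' j else 0)
    (hZji : ∀ (l' : Fin d) (i0 : Fin m) (l : Fin d) (j0 : Fin m),
        Zji (l', i0, l, j0)
          = if i0 = j ∧ j0 = i then sgn (A l j * A l i * A l' j) * A l' i else 0) :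
    (∑ q : Fin d × Fin m × Fin d × Fin m, p q * Zij q)
        = (∑ q : Fin d × Fin m × Fin d × Fin m, p q * Zji q)
    ∧ (∑ q : Fin d × Fin m × Fin d × Fin m, p q * Zij q)
        = (∑ k : Fin d, A k i * A k j) ^ 2 / W1 := by
  have hij := gram_diamond_expectation A W1 hAcol hArow p hp i j Zij hZij
  have hji := gram_diamond_expectation A W1 hAcol hArow p hp j i Zji hZji
  refine ⟨?_, hij⟩
  rw [hij, hji]
  simp only [mul_comm]
end
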